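/- arXiv:2310.05648 — 2 statements merged into one kernel-verified Lean document; each statement's English description precedes it below -/
import Mathlib

section
/- Quasi-optimal smoother (Lemma 2.2). Assume the abstract framework and transfer operators satisfying (5) and (6). Then the composition J_h := J ∘ I_M : V_h → V is a quasi-optimal smoother with constant C_J := Λ_M + Λ_J + Λ_J·Λ_M; that is, ‖v_h − J(I_M v_h)‖_h ≤ (Λ_M + Λ_J + Λ_J·Λ_M) · inf_{v ∈ V} ‖v − v_h‖_h for every v_h ∈ V_h. -/
/-- Triangle inequality for the seminorm of a symmetric positive-semidefinite form. -/
theorem sqrt_form_add_le {X : Type*} [AddCommGroup X] [Module ℝ X] (b : X → X → ℝ)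
    (hadd : ∀ x y z : X, b (x + y) z = b x z + b y z)
    (hsmul : ∀ (c : ℝ) (x y : X), b (c • x) y = c * b x y)
    (hsymm : ∀ x y : X, b x y = b y x)
    (hnn : ∀ x : X, 0 ≤ b x x) (x y : X) :
    Real.sqrt (b (x + y) (x + y)) ≤ Real.sqrt (b x x) + Real.sqrt (b y y) := by
  have expand : ∀ u w : X, b (u + w) (u + w) = b u u + 2 * b u w + b w w := by
    intro u w
    rw [hadd, hsymm u (u + w), hsymm w (u + w), hadd, hadd, hsymm w u]
    ring
  have hq : ∀ t : ℝ, 0 ≤ b x x * (t * t) + (2 * b x y) * t + b y y := by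
    intro t
    have h := hnn (t • x + y)
    rw [expand, hsmul, hsmul, hsymm x (t • x), hsmul] at h
    linarith
  have hd := discrim_le_zero hq
  unfold discrim at hd
  have hcs : b x y ≤ Real.sqrt (b x x) * Real.sqrt (b y y) := by
    rw [← Real.sqrt_mul (hnn x)]
    apply Real.le_sqrt_of_sq_le
    nlinarith
  apply Real.sqrt_le_iff.mpr
  refine ⟨by positivity, ?_⟩
  rw [expand]
  nlinarith [Real.sq_sqrt (hnn x), Real.sq_sqrt (hnn y)]

/-- **Quasi-optimal smoother (Lemma 2.2).**
Under the abstract framework with transfer operators `IM : X → VM` and `J : VM → V`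
satisfying (5) and (6), the composition `J ∘ IM : Vh → V` is a quasi-optimal smoother
with constant `ΛM + ΛJ + ΛJ·ΛM`:
`‖vh − J(IM vh)‖_h ≤ (ΛM + ΛJ + ΛJ·ΛM) · inf_{v ∈ V} ‖v − vh‖_h` for every `vh ∈ Vh`. -/
theorem quasi_optimal_smoother
    {X : Type*} [AddCommGroup X] [Module ℝ X]
    (apw jh : X → X → ℝ)
    (hapw_addl : ∀ x y z : X, apw (x + y) z = apw x z + apw y z)
    (hapw_smull : ∀ (c : ℝ) (x y : X), apw (c • x) y = c * apw x y)
    (hapw_symm : ∀ x y : X, apw x y = apw y x)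
    (hapw_nonneg : ∀ x : X, 0 ≤ apw x x)
    (hjh_addl : ∀ x y z : X, jh (x + y) z = jh x z + jh y z)
    (hjh_smull : ∀ (c : ℝ) (x y : X), jh (c • x) y = c * jh x y)
    (hjh_symm : ∀ x y : X, jh x y = jh y x)
    (hjh_nonneg : ∀ x : X, 0 ≤ jh x x)
    (V VM Vh : Submodule ℝ X)
    (hjh_vanish : ∀ v ∈ V ⊔ VM, ∀ w : X, jh v w = 0)
    (npw nh : X → ℝ)
    (hnpw_def : ∀ x : X, npw x = Real.sqrt (apw x x))
    (hnh_def : ∀ x : X, nh x = Real.sqrt (apw x x + jh x x))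
    (IM J : X →ₗ[ℝ] X)
    (hIM_maps : ∀ x : X, IM x ∈ VM)
    (hJ_maps : ∀ x ∈ VM, J x ∈ V)
    (ΛM ΛJ : ℝ)
    (hΛM : 0 ≤ ΛM) (hΛJ : 0 ≤ ΛJ)
    (h5 : ∀ vh ∈ Vh, nh (vh - IM vh) ≤ ΛM * ⨅ v : V, nh ((v : X) - vh))
    (h6 : ∀ vM ∈ VM, npw (vM - J vM) ≤ ΛJ * ⨅ v : V, npw ((v : X) - vM)) :
    ∀ vh ∈ Vh,
      nh (vh - J (IM vh)) ≤ (ΛM + ΛJ + ΛJ * ΛM) * ⨅ v : V, nh ((v : X) - vh) := by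
  intro vh hvh
  have tri : ∀ x y : X, nh (x + y) ≤ nh x + nh y := by
    intro x y
    rw [hnh_def, hnh_def, hnh_def]
    refine sqrt_form_add_le (fun x y => apw x y + jh x y) ?_ ?_ ?_ ?_ x y
    · intro x y z
      simp only [hapw_addl, hjh_addl]
      ring
    · intro c x y
      simp only [hapw_smull, hjh_smull]
      ring
    · intro x y
      simp only [hapw_symm x y, hjh_symm x y]
    · intro x
      exact add_nonneg (hapw_nonneg x) (hjh_nonneg x)
  have heq : ∀ x ∈ V ⊔ VM, nh x = npw x := by
    intro x hx
    rw [hnh_def, hnpw_def, hjh_vanish x hx, add_zero]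
  have hV : ∀ x ∈ V, x ∈ V ⊔ VM := fun x hx => Submodule.mem_sup_left hx
  have hM : IM vh ∈ V ⊔ VM := Submodule.mem_sup_right (hIM_maps vh)
  have h5' := h5 vh hvh
  have h6' := h6 (IM vh) (hIM_maps vh)
  have hinf : (⨅ v : V, npw ((v : X) - IM vh)) - nh (vh - IM vh)
      ≤ ⨅ v : V, nh ((v : X) - vh) := by
    apply le_ciInf
    intro v
    have h1 : (⨅ v : V, npw ((v : X) - IM vh)) ≤ npw ((v : X) - IM vh) := by
      refine ciInf_le ⟨0, ?_⟩ v
      rintro _ ⟨w, rfl⟩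
      simp only [hnpw_def]
      exact Real.sqrt_nonneg _
    have h2 := tri ((v : X) - vh) (vh - IM vh)
    rw [sub_add_sub_cancel, heq _ (Submodule.sub_mem _ (hV _ v.2) hM)] at h2
    linarith
  have h3 := tri (vh - IM vh) (IM vh - J (IM vh))
  rw [sub_add_sub_cancel,
    heq _ (Submodule.sub_mem _ hM (hV _ (hJ_maps _ (hIM_maps vh))))] at h3
  have h4 : ΛJ * (⨅ v : V, npw ((v : X) - IM vh))
      ≤ ΛJ * ((⨅ v : V, nh ((v : X) - vh)) + ΛM * ⨅ v : V, nh ((v : X) - vh)) :=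
    mul_le_mul_of_nonneg_left (by linarith) hΛJ
  linarith
end

section
/- Quasi-best approximation via transfer operators (Theorem 2.2). Assume the abstract framework, transfer operators satisfying (4), (5) and (6), the discrete bilinear form hypotheses, a constant κ ≥ 0 with |||J(I_M v_h)|||_pw ≤ κ·‖v_h‖_h for all v_h ∈ V_h, and property (H) for J_h := J ∘ I_M with constant Λ_H. Then there exists a constant C > 0, depending only on α, M, Λ_h, Λ_M, Λ_J, Λ_H and κ, such that for every linear functional F : V → ℝ, every u ∈ V with a(u, v) = F(v) for all v ∈ V, and every u_h ∈ V_h with a_h(u_h, v_h) = F(J_h v_h) for all v_h ∈ V_h, one has |||u − J_h u_h|||_pw + ‖u − u_h‖_h ≤ C · inf_{v_M ∈ V_M} |||u − v_M|||_pw. -/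
universe u

/-- Cauchy-Schwarz for a symmetric positive semidefinite form. -/
theorem qba_cs {X : Type*} [AddCommGroup X] [Module ℝ X] (b : X → X → ℝ)
    (hadd : ∀ x y z : X, b (x + y) z = b x z + b y z)
    (hsmul : ∀ (c : ℝ) (x y : X), b (c • x) y = c * b x y)
    (hsymm : ∀ x y : X, b x y = b y x) (hpos : ∀ x : X, 0 ≤ b x x) (x y : X) :
    b x y ≤ Real.sqrt (b x x) * Real.sqrt (b y y) := by
  have h : ∀ t : ℝ, 0 ≤ b x x * (t * t) + (2 * b x y) * t + b y y := by
    intro t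
    have h1 := hpos (t • x + y)
    have h2 : b (t • x + y) (t • x + y) = b x x * (t * t) + (2 * b x y) * t + b y y := by
      rw [hadd, hsmul, hsymm x, hsymm y, hadd, hadd, hsmul, hsmul, hsymm y x]
      ring
    rwa [h2] at h1
  have hd := discrim_le_zero h
  unfold discrim at hd
  rw [← Real.sqrt_mul (hpos x)]
  apply Real.le_sqrt_of_sq_le
  nlinarith

/-- Triangle inequality for the seminorm of a symmetric positive semidefinite form. -/
theorem qba_tri {X : Type*} [AddCommGroup X] [Module ℝ X] (b : X → X → ℝ)
    (hadd : ∀ x y z : X, b (x + y) z = b x z + b y z)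
    (hsmul : ∀ (c : ℝ) (x y : X), b (c • x) y = c * b x y)
    (hsymm : ∀ x y : X, b x y = b y x) (hpos : ∀ x : X, 0 ≤ b x x) (x y : X) :
    Real.sqrt (b (x + y) (x + y)) ≤ Real.sqrt (b x x) + Real.sqrt (b y y) := by
  have hcs := qba_cs b hadd hsmul hsymm hpos x y
  have hx := Real.sqrt_nonneg (b x x)
  have hy := Real.sqrt_nonneg (b y y)
  apply Real.sqrt_le_iff.2 ⟨by positivity, ?_⟩
  have h2 : b (x + y) (x + y) = b x x + 2 * b x y + b y y := by
    rw [hadd, hsymm x, hsymm y, hadd, hadd, hsymm y x]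
    ring
  rw [h2]
  nlinarith [Real.sq_sqrt (hpos x), Real.sq_sqrt (hpos y)]

/-- **Quasi-best approximation via transfer operators (Theorem 2.2).**
Given constants `0 < α ≤ M`, `Λh, ΛM, ΛJ, ΛH, κ ≥ 0`, there exists a constant
`C > 0` (depending only on `α, M, Λh, ΛM, ΛJ, ΛH, κ`) such that for any instance of
the abstract framework with transfer operators `Ih, IM, J` satisfying (4), (5), (6),
a discrete bilinear form `ah` that is `Vh`-elliptic and bounded with constants
`α, M`, a norm `‖·‖_h` positive definite on `V + Vh`,
`|||J(IM vh)|||_pw ≤ κ ‖vh‖_h` on `Vh`, and property (H) for `J_h := J ∘ IM` with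
constant `ΛH`, every linear functional `F`, every solution `u ∈ V` of
`a(u, ·) = F` and every discrete solution `u_h ∈ Vh` of `ah(u_h, ·) = F(J_h ·)`
satisfy `|||u − J_h u_h|||_pw + ‖u − u_h‖_h ≤ C · inf_{vM ∈ VM} |||u − vM|||_pw`. -/
theorem quasi_best_approximation_transfer
    (α M Λh ΛM ΛJ ΛH κ : ℝ)
    (hα : 0 < α) (hαM : α ≤ M) (hΛh : 0 ≤ Λh) (hΛM : 0 ≤ ΛM) (hΛJ : 0 ≤ ΛJ)
    (hΛH : 0 ≤ ΛH) (hκ : 0 ≤ κ) :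
    ∃ C : ℝ, 0 < C ∧
      ∀ (X : Type u) [AddCommGroup X] [Module ℝ X]
        (apw jh : X → X → ℝ),
      (∀ x y z : X, apw (x + y) z = apw x z + apw y z) →
      (∀ (c : ℝ) (x y : X), apw (c • x) y = c * apw x y) →
      (∀ x y : X, apw x y = apw y x) →
      (∀ x : X, 0 ≤ apw x x) →
      (∀ x y z : X, jh (x + y) z = jh x z + jh y z) →
      (∀ (c : ℝ) (x y : X), jh (c • x) y = c * jh x y) →
      (∀ x y : X, jh x y = jh y x) →
      (∀ x : X, 0 ≤ jh x x) →
      ∀ (V VM Vh : Submodule ℝ X),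
      (∀ v ∈ V ⊔ VM, ∀ w : X, jh v w = 0) →
      ∀ (npw nh : X → ℝ),
      (∀ x : X, npw x = Real.sqrt (apw x x)) →
      (∀ x : X, nh x = Real.sqrt (apw x x + jh x x)) →
      ∀ (Ih IM J : X →ₗ[ℝ] X),
      (∀ x ∈ VM, Ih x ∈ Vh) →
      (∀ x : X, IM x ∈ VM) →
      (∀ x ∈ VM, J x ∈ V) →
      (∀ vM ∈ VM, nh (vM - Ih vM) ≤ Λh * ⨅ v : V, npw ((v : X) - vM)) →
      (∀ vh ∈ Vh, nh (vh - IM vh) ≤ ΛM * ⨅ v : V, nh ((v : X) - vh)) →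
      (∀ vM ∈ VM, npw (vM - J vM) ≤ ΛJ * ⨅ v : V, npw ((v : X) - vM)) →
      ∀ (ah : X → X → ℝ),
      (∀ x y z : X, ah (x + y) z = ah x z + ah y z) →
      (∀ (c : ℝ) (x y : X), ah (c • x) y = c * ah x y) →
      (∀ x y z : X, ah x (y + z) = ah x y + ah x z) →
      (∀ (c : ℝ) (x y : X), ah x (c • y) = c * ah x y) →
      (∀ vh ∈ Vh, α * nh vh ^ 2 ≤ ah vh vh) →
      (∀ vh ∈ Vh, ∀ wh ∈ Vh, ah vh wh ≤ M * nh vh * nh wh) →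
      (∀ x ∈ V ⊔ Vh, nh x = 0 → x = 0) →
      (∀ vh ∈ Vh, npw (J (IM vh)) ≤ κ * nh vh) →
      (∀ wh ∈ Vh, ∀ vh ∈ Vh,
        ah wh vh - apw (J (IM wh)) (J (IM vh)) ≤ ΛH * nh (wh - J (IM wh)) * nh vh) →
      ∀ (F : X →ₗ[ℝ] ℝ) (u u_h : X),
      u ∈ V → (∀ v ∈ V, apw u v = F v) →
      u_h ∈ Vh → (∀ vh ∈ Vh, ah u_h vh = F (J (IM vh))) →
      npw (u - J (IM u_h)) + nh (u - u_h) ≤ C * ⨅ vM : VM, npw (u - (vM : X)) := by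
  obtain ⟨K, hK⟩ : ∃ K, K = ΛM + ΛJ * (1 + ΛM) := ⟨_, rfl⟩
  have hK0 : 0 ≤ K := by rw [hK]; positivity
  obtain ⟨D, hD⟩ : ∃ D, D = (1 + Λh) * (1 + (ΛH * K + κ * (1 + K)) / α) := ⟨_, rfl⟩
  have hD0 : 0 < D := by rw [hD]; positivity
  have hC0 : 0 < (2 + K) * D := by positivity
  refine ⟨(2 + K) * D, hC0, ?_⟩
  intro X _ _ apw jh padd psmul psymm ppos jadd jsmul jsymm jpos V VM Vh jz npw nh hnpw hnh
    Ih IM J hIh hIM hJ h4 h5 h6 ah aadd asmul aaddr asmulr aell abdd _ hkap hH F u u_h hu huF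
    huh huhF
  have npw0 : ∀ x, 0 ≤ npw x := fun x => by rw [hnpw]; exact Real.sqrt_nonneg _
  have nh0 : ∀ x, 0 ≤ nh x := fun x => by rw [hnh]; exact Real.sqrt_nonneg _
  have nle : ∀ x, npw x ≤ nh x := fun x => by
    rw [hnpw, hnh]; exact Real.sqrt_le_sqrt (by linarith [jpos x])
  have neq : ∀ x ∈ V ⊔ VM, nh x = npw x := fun x hx => by
    rw [hnpw, hnh, jz x hx, add_zero]
  have ntri : ∀ x y, nh (x + y) ≤ nh x + nh y := fun x y => by
    rw [hnh, hnh, hnh]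
    exact qba_tri (fun x y => apw x y + jh x y)
      (fun x y z => by simp only [padd, jadd]; ring)
      (fun c x y => by simp only [psmul, jsmul]; ring)
      (fun x y => by simp only [psymm x y, jsymm x y])
      (fun x => add_nonneg (ppos x) (jpos x)) x y
  have nneg : ∀ x, nh (-x) = nh x := fun x => by
    rw [hnh, hnh]
    have e1 : apw (-x) (-x) = apw x x := by
      rw [← neg_one_smul ℝ x, psmul, psymm, psmul]; ring
    have e2 : jh (-x) (-x) = jh x x := by
      rw [← neg_one_smul ℝ x, jsmul, jsymm, jsmul]; ring
    rw [e1, e2]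
  have nsub : ∀ x y z, nh (x - z) ≤ nh (x - y) + nh (y - z) := fun x y z => by
    have := ntri (x - y) (y - z)
    rwa [sub_add_sub_cancel] at this
  have cs : ∀ x y, apw x y ≤ npw x * npw y := fun x y => by
    rw [hnpw, hnpw]; exact qba_cs apw padd psmul psymm ppos x y
  have inf1 : ∀ y, (⨅ v : V, npw ((v : X) - y)) ≤ npw (u - y) := fun y =>
    ciInf_le (f := fun v : V => npw ((v : X) - y))
      ⟨0, by rintro _ ⟨v, rfl⟩; exact npw0 _⟩ ⟨u, hu⟩
  have inf2 : ∀ y, (⨅ v : V, nh ((v : X) - y)) ≤ nh (u - y) := fun y =>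
    ciInf_le (f := fun v : V => nh ((v : X) - y))
      ⟨0, by rintro _ ⟨v, rfl⟩; exact nh0 _⟩ ⟨u, hu⟩
  have hJK : ∀ w ∈ Vh, nh (w - J (IM w)) ≤ K * nh (u - w) := by
    intro w hw
    have a1 : nh (w - IM w) ≤ ΛM * nh (u - w) :=
      (h5 w hw).trans (mul_le_mul_of_nonneg_left (inf2 w) hΛM)
    have a2 : npw (IM w - J (IM w)) ≤ ΛJ * npw (u - IM w) :=
      (h6 _ (hIM w)).trans (mul_le_mul_of_nonneg_left (inf1 _) hΛJ)
    have a3 : nh (IM w - J (IM w)) = npw (IM w - J (IM w)) :=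
      neq _ (Submodule.sub_mem _ (Submodule.mem_sup_right (hIM w))
        (Submodule.mem_sup_left (hJ _ (hIM w))))
    have a4 : npw (u - IM w) ≤ (1 + ΛM) * nh (u - w) := by
      linarith [nle (u - IM w), nsub u w (IM w)]
    have a5 := mul_le_mul_of_nonneg_left a4 hΛJ
    have a6 := nsub w (IM w) (J (IM w))
    rw [hK]
    linarith
  have key : ∀ vM : VM, npw (u - J (IM u_h)) + nh (u - u_h) ≤
      ((2 + K) * D) * npw (u - (vM : X)) := by
    rintro ⟨vM, hvM⟩
    simp only
    obtain ⟨δ, hδ⟩ : ∃ δ, δ = npw (u - vM) := ⟨_, rfl⟩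
    have hδ0 : 0 ≤ δ := hδ ▸ npw0 _
    rw [← hδ]
    obtain ⟨w, hw⟩ : ∃ w, w = Ih vM := ⟨_, rfl⟩
    have hwV : w ∈ Vh := hw ▸ hIh _ hvM
    have b1 : nh (vM - w) ≤ Λh * δ := by
      rw [hw, hδ]
      exact (h4 vM hvM).trans (mul_le_mul_of_nonneg_left (inf1 vM) hΛh)
    have b2 : nh (u - vM) = δ := by
      rw [hδ]
      exact neq _ (Submodule.sub_mem _ (Submodule.mem_sup_left hu)
        (Submodule.mem_sup_right hvM))
    have b3 : nh (u - w) ≤ (1 + Λh) * δ := by linarith [nsub u vM w]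
    have b4 := hJK w hwV
    obtain ⟨e, he⟩ : ∃ e, e = u_h - w := ⟨_, rfl⟩
    have heV : e ∈ Vh := he ▸ Submodule.sub_mem _ huh hwV
    have c1 := aell e heV
    have c2 : ah e e = ah u_h e - ah w e := by
      have : e = u_h + (-1 : ℝ) • w := by rw [he, neg_one_smul, sub_eq_add_neg]
      conv_lhs => rw [show ah e e = ah (u_h + (-1 : ℝ) • w) e by rw [← this]]
      rw [aadd, asmul]; ring
    have c3 : ah u_h e = apw u (J (IM e)) := by
      rw [huhF e heV, huF _ (hJ _ (hIM e))]
    have c4 : apw (J (IM w)) (J (IM e)) - ah w e ≤ ΛH * nh (w - J (IM w)) * nh e := by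
      have := hH ((-1 : ℝ) • w) (Submodule.smul_mem _ _ hwV) e heV
      rw [map_smul, map_smul, asmul, psmul, ← smul_sub, neg_one_smul, nneg] at this
      linarith
    have c5 : apw (u - J (IM w)) (J (IM e)) = apw u (J (IM e)) - apw (J (IM w)) (J (IM e)) := by
      rw [sub_eq_add_neg, ← neg_one_smul ℝ (J (IM w)), padd, psmul]; ring
    have c6 := cs (u - J (IM w)) (J (IM e))
    have c7 : npw (u - J (IM w)) ≤ (1 + K) * nh (u - w) := by
      linarith [nle (u - J (IM w)), nsub u w (J (IM w))]
    have c8 : npw (u - J (IM w)) * npw (J (IM e)) ≤ ((1 + K) * nh (u - w)) * (κ * nh e) :=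
      mul_le_mul c7 (hkap e heV) (npw0 _) ((npw0 _).trans c7)
    have c9 : ΛH * nh (w - J (IM w)) * nh e ≤ ΛH * (K * nh (u - w)) * nh e :=
      mul_le_mul_of_nonneg_right (mul_le_mul_of_nonneg_left b4 hΛH) (nh0 e)
    have d1 : α * nh e ^ 2 ≤ ((ΛH * K + κ * (1 + K)) * nh (u - w)) * nh e := by
      linarith
    have hQ0 : 0 ≤ ΛH * K + κ * (1 + K) := by positivity
    have d2 : α * nh e ≤ (ΛH * K + κ * (1 + K)) * nh (u - w) := by
      rcases (nh0 e).eq_or_lt with h | h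
      · rw [← h, mul_zero]; exact mul_nonneg hQ0 (nh0 _)
      · exact le_of_mul_le_mul_right (by linarith) h
    have d3 : nh e ≤ (ΛH * K + κ * (1 + K)) / α * nh (u - w) := by
      rw [div_mul_eq_mul_div, le_div_iff₀ hα]; linarith
    have d4 : nh (u - u_h) ≤ nh (u - w) + nh e := by
      have := nsub u w u_h
      rwa [← nneg (w - u_h), neg_sub, ← he] at this
    have d5 : nh (u - u_h) ≤ D * δ := by
      have h1 : 0 ≤ 1 + (ΛH * K + κ * (1 + K)) / α := by positivity
      have := mul_le_mul_of_nonneg_left b3 h1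
      rw [hD]
      linarith
    have d6 : npw (u - J (IM u_h)) ≤ (1 + K) * nh (u - u_h) := by
      linarith [nle (u - J (IM u_h)), nsub u u_h (J (IM u_h)), hJK u_h huh]
    have d7 := mul_le_mul_of_nonneg_left d5 (show 0 ≤ 2 + K by positivity)
    linarith
  rw [← div_le_iff₀' hC0]
  apply le_ciInf
  intro vM
  rw [div_le_iff₀' hC0]
  exact key vM
end
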